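/- arXiv:2201.09866 — 11 statements merged into one kernel-verified Lean document; each statement's English description precedes it below -/
import Mathlib

section
/- Let n be a positive integer and let S : ι → Finset (Fin n) be a finite family of supports. Let P be the (finite) set of all nonzero symplectic vectors a : Fin n → ZMod 2 × ZMod 2 whose support is contained in S i for some i ∈ ι. Then the square real matrix M(P,P), indexed by P × P and with (a,b) entry equal to 1 if ⟨a,b⟩_sp = 1 and 0 otherwise, is invertible. -/
/-- Symplectic inner product of two symplectic vectors over `Fin n`. -/
def spInner {n : ℕ} (a b : Fin n → ZMod 2 × ZMod 2) : ZMod 2 :=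
  ∑ i, ((a i).1 * (b i).2 + (a i).2 * (b i).1)

/-- The real 0/1 anticommutation matrix `M(B,K)`. -/
def spMatrix {n : ℕ} {ι κ : Type*} (B : ι → (Fin n → ZMod 2 × ZMod 2))
    (K : κ → (Fin n → ZMod 2 × ZMod 2)) : Matrix ι κ ℝ :=
  Matrix.of fun b k => if spInner (B b) (K k) = 1 then 1 else 0

/-- The real sign character of `ZMod 2`. -/
def zmodTwoSign (x : ZMod 2) : ℝ := if x = 1 then -1 else 1

theorem zmodTwoSign_add (x y : ZMod 2) :
    zmodTwoSign (x + y) = zmodTwoSign x * zmodTwoSign y := by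
  have key : ∀ x y : ZMod 2, (x + y = 1) ↔ ((x = 1 ∧ y ≠ 1) ∨ (x ≠ 1 ∧ y = 1)) := by decide
  unfold zmodTwoSign
  by_cases hx : x = 1 <;> by_cases hy : y = 1 <;> simp [key, hx, hy]

theorem spInner_cons {n : ℕ} (p q : ZMod 2 × ZMod 2) (a b : Fin n → ZMod 2 × ZMod 2) :
    spInner (Fin.cons p a : Fin (n + 1) → ZMod 2 × ZMod 2) (Fin.cons q b) =
      (p.1 * q.2 + p.2 * q.1) + spInner a b := by
  simp [spInner, Fin.sum_univ_succ]

theorem sum_zmodTwoSign_spInner_cons {n : ℕ} (w : (Fin (n + 1) → ZMod 2 × ZMod 2) → ℝ)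
    (p : ZMod 2 × ZMod 2) (a : Fin n → ZMod 2 × ZMod 2) :
    ∑ b, zmodTwoSign (spInner (Fin.cons p a : Fin (n + 1) → ZMod 2 × ZMod 2) b) * w b =
      ∑ q : ZMod 2 × ZMod 2, zmodTwoSign (p.1 * q.2 + p.2 * q.1) *
        ∑ b, zmodTwoSign (spInner a b) * w (Fin.cons q b) := by
  rw [← (Fin.consEquiv fun _ : Fin (n + 1) => ZMod 2 × ZMod 2).sum_comp, Fintype.sum_prod_type]
  refine Finset.sum_congr rfl fun q _ => ?_
  rw [Finset.mul_sum]
  refine Finset.sum_congr rfl fun b _ => ?_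
  simp only [Fin.consEquiv, Equiv.coe_fn_mk]
  rw [spInner_cons, zmodTwoSign_add, mul_assoc]

/-- The one-qubit character table is nonsingular. -/
theorem eq_zero_of_sum_zmodTwoSign_eq_zero (u : ZMod 2 × ZMod 2 → ℝ)
    (h : ∀ p : ZMod 2 × ZMod 2,
      ∑ q : ZMod 2 × ZMod 2, zmodTwoSign (p.1 * q.2 + p.2 * q.1) * u q = 0) :
    u = 0 := by
  have e : ∀ f : ZMod 2 × ZMod 2 → ℝ, ∑ q, f q = f (0, 0) + f (0, 1) + (f (1, 0) + f (1, 1)) := by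
    intro f
    rw [Fintype.sum_prod_type]
    exact (Fin.sum_univ_two _).trans (congrArg₂ _ (Fin.sum_univ_two _) (Fin.sum_univ_two _))
  have h11 : (1 + 1 : ZMod 2) = 0 := rfl
  have h00 := h (0, 0)
  have h01 := h (0, 1)
  have h10 := h (1, 0)
  have h1 := h (1, 1)
  simp [e, zmodTwoSign, h11] at h00 h01 h10 h1
  have c : ∀ q : ZMod 2 × ZMod 2, q = (0, 0) ∨ q = (0, 1) ∨ q = (1, 0) ∨ q = (1, 1) := by decide
  funext q
  rcases c q with rfl | rfl | rfl | rfl <;> simp only [Pi.zero_apply] <;> linarith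

/-- On a set of symplectic vectors closed under shrinking the support, the character table
`(-1) ^ ⟨a, b⟩` is nonsingular. -/
theorem eq_zero_of_sum_zmodTwoSign_spInner_eq_zero {n : ℕ}
    (D : Set (Fin n → ZMod 2 × ZMod 2))
    (hD : ∀ a ∈ D, ∀ b, (∀ j, b j ≠ 0 → a j ≠ 0) → b ∈ D)
    (w : (Fin n → ZMod 2 × ZMod 2) → ℝ) (hw : ∀ a ∉ D, w a = 0)
    (h : ∀ a ∈ D, ∑ b, zmodTwoSign (spInner a b) * w b = 0) : w = 0 := by
  induction n with
  | zero =>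
    funext a
    by_cases ha : a ∈ D
    · have h_sum := h a ha
      rw [Fintype.sum_subsingleton _ a] at h_sum
      simpa [spInner, zmodTwoSign] using h_sum
    · exact hw a ha
  | succ n ih =>
    have slice_closed : ∀ p, ∀ a ∈ {a | (Fin.cons p a : Fin (n + 1) → ZMod 2 × ZMod 2) ∈ D},
        ∀ b, (∀ j, b j ≠ 0 → a j ≠ 0) →
          b ∈ {a | (Fin.cons p a : Fin (n + 1) → ZMod 2 × ZMod 2) ∈ D} := by
      intro p a ha b hb
      refine hD _ ha _ fun j => ?_
      refine Fin.cases ?_ (fun j => ?_) j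
      · simp
      · simpa using hb j
    have change_head : ∀ p q a, p ≠ 0 →
        (Fin.cons p a : Fin (n + 1) → ZMod 2 × ZMod 2) ∈ D →
          (Fin.cons q a : Fin (n + 1) → ZMod 2 × ZMod 2) ∈ D := by
      intro p q a hp ha
      refine hD _ ha _ fun j => ?_
      refine Fin.cases ?_ (fun j => ?_) j
      · simp [hp]
      · simp
    have w_head_ne_zero : ∀ q, q ≠ 0 →
        (fun b => w (Fin.cons q b : Fin (n + 1) → ZMod 2 × ZMod 2)) = 0 := by
      intro q hq
      refine ih _ (slice_closed q) _ (fun a ha => hw _ ha) fun a ha => ?_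
      refine congrFun (eq_zero_of_sum_zmodTwoSign_eq_zero
        (fun q => ∑ b, zmodTwoSign (spInner a b) * w (Fin.cons q b)) fun p => ?_) q
      rw [← sum_zmodTwoSign_spInner_cons]
      exact h _ (change_head q p a hq ha)
    have w_head_zero :
        (fun b => w (Fin.cons 0 b : Fin (n + 1) → ZMod 2 × ZMod 2)) = 0 := by
      refine ih _ (slice_closed 0) _ (fun a ha => hw _ ha) fun a ha => ?_
      have h0 := h _ ha
      rw [sum_zmodTwoSign_spInner_cons, Finset.sum_eq_single 0] at h0
      · simpa [zmodTwoSign] using h0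
      · intro q _ hq
        simp [fun b => congrFun (w_head_ne_zero q hq) b]
      · simp
    funext a
    rw [← Fin.cons_self_tail a]
    by_cases h0 : a 0 = 0
    · rw [h0]
      exact congrFun w_head_zero _
    · exact congrFun (w_head_ne_zero _ h0) _

theorem stmt0 (n : ℕ) (hn : 0 < n) {ι : Type*} [Fintype ι]
    (S : ι → Finset (Fin n))
    (P : Finset (Fin n → ZMod 2 × ZMod 2))
    (hP : ∀ a : Fin n → ZMod 2 × ZMod 2,
      a ∈ P ↔ a ≠ 0 ∧ ∃ i : ι, ∀ j : Fin n, a j ≠ 0 → j ∈ S i) :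
    IsUnit (spMatrix (fun a : ↥P => (a : Fin n → ZMod 2 × ZMod 2))
      (fun a : ↥P => (a : Fin n → ZMod 2 × ZMod 2))) := by
  classical
  rw [← Matrix.mulVec_injective_iff_isUnit, ← Matrix.coe_mulVecLin, ← LinearMap.ker_eq_bot,
    LinearMap.ker_eq_bot']
  intro v hv
  rw [Matrix.mulVecLin_apply] at hv
  have h0P : (0 : Fin n → ZMod 2 × ZMod 2) ∉ P := fun h => ((hP 0).1 h).1 rfl
  let w : (Fin n → ZMod 2 × ZMod 2) → ℝ := fun a =>
    if ha : a ∈ P then v ⟨a, ha⟩ else if a = 0 then -∑ x, v x else 0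
  have hwP : ∀ x : P, w x = v x := fun x => by simp [w]
  have hw0 : w 0 = -∑ x, v x := by simp [w, h0P]
  have sum_mul_w : ∀ f : (Fin n → ZMod 2 × ZMod 2) → ℝ,
      ∑ b, f b * w b = f 0 * (-∑ x, v x) + ∑ x : P, f x * v x := by
    intro f
    rw [← Finset.sum_subset (Finset.subset_univ (insert 0 P)), Finset.sum_insert h0P, hw0,
      ← Finset.sum_coe_sort P]
    · simp only [hwP]
    · intro x _ hx
      rw [Finset.mem_insert, not_or] at hx
      simp [w, hx.1, hx.2]
  have hw : w = 0 := by
    refine eq_zero_of_sum_zmodTwoSign_spInner_eq_zero {a | a = 0 ∨ a ∈ P} ?_ w ?_ ?_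
    · rintro a ha b hb
      by_cases hb0 : b = 0
      · exact Or.inl hb0
      rcases ha with rfl | ha
      · exact absurd (funext fun j => by_contra fun hj => hb j hj rfl) hb0
      · obtain ⟨-, i, hi⟩ := (hP a).1 ha
        exact Or.inr ((hP b).2 ⟨hb0, i, fun j hj => hi j (hb j hj)⟩)
    · intro a ha
      rw [Set.mem_ofPred_eq, not_or] at ha
      simp [w, ha.1, ha.2]
    · rintro a (rfl | ha)
      · rw [sum_mul_w]
        simp [spInner, zmodTwoSign]
      · have hva := congrFun hv ⟨a, ha⟩
        simp only [Matrix.mulVec, dotProduct, spMatrix, Matrix.of_apply, Pi.zero_apply] at hva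
        have sign_eq : ∀ x : ZMod 2, zmodTwoSign x = 1 - 2 * (if x = 1 then 1 else 0) := by
          intro x
          unfold zmodTwoSign
          split_ifs <;> norm_num
        have spInner_zero : spInner a 0 = 0 := by simp [spInner]
        rw [sum_mul_w, spInner_zero]
        simp only [sign_eq, sub_mul, Finset.sum_sub_distrib, mul_assoc, ← Finset.mul_sum, hva]
        simp
  funext x
  rw [← hwP, hw]
  rfl
end

section
/- Let G be a simple graph on the vertex set Fin n, and let K be the finite set of all nonzero symplectic vectors a : Fin n → ZMod 2 × ZMod 2 whose support is either a single vertex {i} or a pair {i,j} of adjacent vertices of G. Then the square real matrix M(K,K), with (a,b) entry equal to 1 if ⟨a,b⟩_sp = 1 and 0 otherwise, is invertible. -/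
/-- The support of a symplectic vector, as a set. -/
def spSupport {n : ℕ} (a : Fin n → ZMod 2 × ZMod 2) : Set (Fin n) :=
  {i | a i ≠ 0}

theorem spInner_add_left {n : ℕ} (a b c : Fin n → ZMod 2 × ZMod 2) :
    spInner (a + b) c = spInner a c + spInner b c := by
  simp only [spInner, ← Finset.sum_add_distrib, Pi.add_apply, Prod.fst_add, Prod.snd_add]
  exact Finset.sum_congr rfl fun i _ => by ring

theorem spInner_add_right {n : ℕ} (a b c : Fin n → ZMod 2 × ZMod 2) :
    spInner a (b + c) = spInner a b + spInner a c := by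
  simp only [spInner, ← Finset.sum_add_distrib, Pi.add_apply, Prod.fst_add, Prod.snd_add]
  exact Finset.sum_congr rfl fun i _ => by ring

theorem spInner_single_left {n : ℕ} (i : Fin n) (p : ZMod 2 × ZMod 2)
    (c : Fin n → ZMod 2 × ZMod 2) :
    spInner (Pi.single i p) c = p.1 * (c i).2 + p.2 * (c i).1 := by
  rw [spInner, Finset.sum_eq_single i]
  · simp
  · intro j _ hj
    simp [hj]
  · simp

theorem spInner_eq_zero_of_disjoint {n : ℕ} {a b : Fin n → ZMod 2 × ZMod 2}
    (h : ∀ i ∈ spSupport a, b i = 0) : spInner a b = 0 := by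
  refine Finset.sum_eq_zero fun i _ => ?_
  by_cases ha : a i = 0
  · simp [ha]
  · simp [h i ha]

theorem add_self_eq_zero_of_symplectic {n : ℕ} (a : Fin n → ZMod 2 × ZMod 2) : a + a = 0 := by
  have h : ∀ p : ZMod 2 × ZMod 2, p + p = 0 := by decide
  exact funext fun i => h (a i)

open Classical in
/-- Orthogonality of characters: the signs of a vector not vanishing on `T` cancel. -/
theorem sum_sign_eq_zero {n : ℕ} (T : Set (Fin n)) (c : Fin n → ZMod 2 × ZMod 2)
    (hc : ∃ i ∈ T, c i ≠ 0) :
    ∑ b with spSupport b ⊆ T, zmodTwoSign (spInner b c) = 0 := by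
  obtain ⟨i, hi, hci⟩ := hc
  have hnondeg : ∀ q : ZMod 2 × ZMod 2, q ≠ 0 →
      ∃ p : ZMod 2 × ZMod 2, p.1 * q.2 + p.2 * q.1 = 1 := by decide
  obtain ⟨p, hp⟩ := hnondeg (c i) hci
  set e : Fin n → ZMod 2 × ZMod 2 := Pi.single i p with he
  have hmem : ∀ b, spSupport b ⊆ T → spSupport (b + e) ⊆ T := by
    intro b hb j hj
    by_cases hji : j = i
    · exact hji ▸ hi
    · exact hb (by simpa [spSupport, he, hji] using hj)
  have hinv : ∀ b : Fin n → ZMod 2 × ZMod 2, b + e + e = b := fun b => by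
    rw [add_assoc, add_self_eq_zero_of_symplectic, add_zero]
  have hneg : ∑ b with spSupport b ⊆ T, zmodTwoSign (spInner b c) =
      ∑ b with spSupport b ⊆ T, -zmodTwoSign (spInner b c) := by
    refine Finset.sum_bij' (fun b _ => b + e) (fun b _ => b + e) ?_ ?_ ?_ ?_ ?_
    · simpa using hmem
    · simpa using hmem
    · exact fun b _ => hinv b
    · exact fun b _ => hinv b
    · intro b _
      rw [spInner_add_left, zmodTwoSign_add, he, spInner_single_left, hp]
      simp [zmodTwoSign]
  rw [Finset.sum_neg_distrib] at hneg
  linarith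

open Classical in
theorem sum_sign_pos {n : ℕ} (T : Set (Fin n)) (c : Fin n → ZMod 2 × ZMod 2)
    (hc : ∀ i ∈ T, c i = 0) :
    0 < ∑ b with spSupport b ⊆ T, zmodTwoSign (spInner b c) := by
  refine Finset.sum_pos (fun b hb => ?_)
    ⟨0, Finset.mem_filter.mpr ⟨Finset.mem_univ _, fun i hi => absurd rfl hi⟩⟩
  have hb' : spSupport b ⊆ T := by simpa using hb
  simp [spInner_eq_zero_of_disjoint fun i hi => hc i (hb' hi), zmodTwoSign]

/-- The anticommutation matrix of a family of nonzero symplectic vectors that is closed under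
passing to nonzero vectors of smaller support is invertible. -/
theorem isUnit_spMatrix_of_support_closed {n : ℕ} (K : Finset (Fin n → ZMod 2 × ZMod 2))
    (hne : ∀ a ∈ K, a ≠ 0)
    (hsub : ∀ a ∈ K, ∀ b, b ≠ 0 → spSupport b ⊆ spSupport a → b ∈ K) :
    IsUnit (spMatrix (fun a : ↥K => (a : Fin n → ZMod 2 × ZMod 2))
      (fun a : ↥K => (a : Fin n → ZMod 2 × ZMod 2))) := by
  classical
  rw [← Matrix.mulVec_injective_iff_isUnit, ← Matrix.coe_mulVecLin, injective_iff_map_eq_zero]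
  intro v hv
  by_contra hv0
  obtain ⟨k₁, hk₁⟩ := Function.ne_iff.mp hv0
  obtain ⟨a, ha, hmax⟩ := Finset.exists_max_image ({k | v k ≠ 0} : Finset ↥K)
    (fun k => (spSupport k.1).ncard) ⟨k₁, by simpa using hk₁⟩
  have hva : v a ≠ 0 := by simpa using ha
  have hrow : ∀ b, spSupport b ⊆ spSupport a.1 →
      ∑ k : ↥K, (1 - zmodTwoSign (spInner b k.1)) * v k = 0 := by
    intro b hb
    by_cases hb0 : b = 0
    · subst hb0
      simp [spInner, zmodTwoSign]
    · have h := congrFun hv ⟨b, hsub a a.2 b hb0 hb⟩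
      have h2 : ∑ k : ↥K, (1 - zmodTwoSign (spInner b k.1)) * v k =
          2 * ∑ k : ↥K, (if spInner b k.1 = 1 then (1 : ℝ) else 0) * v k := by
        rw [Finset.mul_sum]
        refine Finset.sum_congr rfl fun k _ => ?_
        unfold zmodTwoSign
        split_ifs <;> ring
      rw [h2]
      simpa [Matrix.mulVec, dotProduct, spMatrix] using h
  have hsum : ∑ k : ↥K, (∑ b with spSupport b ⊆ spSupport a.1,
      zmodTwoSign (spInner b (a.1 + k.1))) * v k = 0 := by
    have hzero : ∑ b with spSupport b ⊆ spSupport a.1, zmodTwoSign (spInner b a.1) = 0 := by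
      obtain ⟨i, hi⟩ := Function.ne_iff.mp (hne a a.2)
      exact sum_sign_eq_zero _ _ ⟨i, hi, hi⟩
    calc _ = ∑ k : ↥K, (∑ b with spSupport b ⊆ spSupport a.1,
          zmodTwoSign (spInner b a.1) * zmodTwoSign (spInner b k.1)) * v k := by
          simp only [spInner_add_right, zmodTwoSign_add]
      _ = ∑ k : ↥K, (-∑ b with spSupport b ⊆ spSupport a.1,
          zmodTwoSign (spInner b a.1) * (1 - zmodTwoSign (spInner b k.1))) * v k := by
          simp only [mul_sub, mul_one, Finset.sum_sub_distrib, hzero, zero_sub, neg_neg]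
      _ = -∑ b with spSupport b ⊆ spSupport a.1, zmodTwoSign (spInner b a.1) *
          ∑ k : ↥K, (1 - zmodTwoSign (spInner b k.1)) * v k := by
          simp only [neg_mul, Finset.sum_neg_distrib, Finset.sum_mul, Finset.mul_sum, mul_assoc]
          rw [Finset.sum_comm]
      _ = 0 := by
          rw [neg_eq_zero]
          exact Finset.sum_eq_zero fun b hb => by
            rw [hrow b (by simpa using hb), mul_zero]
  rw [Finset.sum_eq_single a] at hsum
  · have hpos := sum_sign_pos (spSupport a.1) (a.1 + a.1) fun i _ => by
      rw [add_self_eq_zero_of_symplectic, Pi.zero_apply]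
    exact (mul_ne_zero hpos.ne' hva) hsum
  · intro k _ hka
    by_cases hvk : v k = 0
    · rw [hvk, mul_zero]
    rw [sum_sign_eq_zero, zero_mul]
    by_contra! hagree
    have heq : ∀ i ∈ spSupport a.1, k.1 i = a.1 i := by
      have h : ∀ p q : ZMod 2 × ZMod 2, p + q = 0 → q = p := by decide
      exact fun i hi => h _ _ (hagree i hi)
    have hle : spSupport a.1 ⊆ spSupport k.1 := fun i hi => by
      change k.1 i ≠ 0
      rw [heq i hi]
      exact hi
    have hsupp : spSupport a.1 = spSupport k.1 :=
      Set.eq_of_subset_of_ncard_le hle (hmax k (by simpa using hvk)) (Set.toFinite _)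
    refine hka (Subtype.ext (funext fun i => ?_))
    by_cases hi : i ∈ spSupport a.1
    · exact heq i hi
    · have hk : k.1 i = 0 := by
        rw [hsupp] at hi
        exact not_not.mp hi
      rw [hk]
      exact (not_not.mp hi).symm
  · simp

theorem stmt1 (n : ℕ) (hn : 0 < n) (G : SimpleGraph (Fin n))
    (K : Finset (Fin n → ZMod 2 × ZMod 2))
    (hK : ∀ a : Fin n → ZMod 2 × ZMod 2,
      a ∈ K ↔ (∃ i : Fin n, spSupport a = {i}) ∨
        (∃ i j : Fin n, G.Adj i j ∧ spSupport a = {i, j})) :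
    IsUnit (spMatrix (fun a : ↥K => (a : Fin n → ZMod 2 × ZMod 2))
      (fun a : ↥K => (a : Fin n → ZMod 2 × ZMod 2))) := by
  apply isUnit_spMatrix_of_support_closed
  · rintro a ha rfl
    have hempty : spSupport (0 : Fin n → ZMod 2 × ZMod 2) = ∅ := by simp [spSupport]
    rcases (hK 0).mp ha with ⟨i, hi⟩ | ⟨i, j, -, hij⟩
    · exact Set.singleton_ne_empty i (hi.symm.trans hempty)
    · exact (Set.insert_nonempty i {j}).ne_empty (hij.symm.trans hempty)
  · intro a ha b hb hba
    have hbne : spSupport b ≠ ∅ := by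
      obtain ⟨i, hi⟩ := Function.ne_iff.mp hb
      exact Set.Nonempty.ne_empty ⟨i, hi⟩
    rw [hK]
    rcases (hK a).mp ha with ⟨i, hi⟩ | ⟨i, j, hadj, hij⟩
    · rw [hi, Set.subset_singleton_iff_eq] at hba
      exact Or.inl ⟨i, hba.resolve_left hbne⟩
    · rw [hij, Set.subset_pair_iff_eq] at hba
      rcases hba with h | h | h | h
      · exact absurd h hbne
      · exact Or.inl ⟨i, h⟩
      · exact Or.inl ⟨j, h⟩
      · exact Or.inr ⟨i, j, hadj, h⟩
end

section
/- Let k be a positive integer and let α, f, ε, e₀, e_k be real numbers with α ≥ 1/2, 0 < f, f^k ≥ 1/2, f ≤ 1, 0 ≤ ε < 1/4, |e₀| ≤ ε and |e_k| ≤ ε, and assume α·f^k − ε > 0. Let f̂ > 0 be defined by f̂^k = (α·f^k + e_k)/(α + e₀). Then f^k·(1 − 4ε)/(1 + 2ε) ≤ f̂^k ≤ f^k·(1 + 4ε)/(1 − 2ε), and consequently |log f̂ − log f| ≤ (1/k)·log((1 + 4ε)/(1 − 4ε)). -/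
theorem stmt3 (k : ℕ) (hk : 0 < k) (α f ε e₀ ek fhat : ℝ)
    (hα : 1 / 2 ≤ α) (hf0 : 0 < f) (hfk : 1 / 2 ≤ f ^ k) (hf1 : f ≤ 1)
    (hε0 : 0 ≤ ε) (hε : ε < 1 / 4)
    (he₀ : |e₀| ≤ ε) (hek : |ek| ≤ ε)
    (hpos : 0 < α * f ^ k + ek)
    (hfhat : 0 < fhat)
    (hdef : fhat ^ k = (α * f ^ k + ek) / (α + e₀)) :
    f ^ k * (1 - 4 * ε) / (1 + 2 * ε) ≤ fhat ^ k ∧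
      fhat ^ k ≤ f ^ k * (1 + 4 * ε) / (1 - 2 * ε) ∧
      |Real.log fhat - Real.log f| ≤ (1 / k) * Real.log ((1 + 4 * ε) / (1 - 4 * ε)) := by
  obtain ⟨he₀l, he₀u⟩ := abs_le.mp he₀
  obtain ⟨hekl, heku⟩ := abs_le.mp hek
  have hαpos : 0 < α := by linarith
  have hfkpos : 0 < f ^ k := by positivity
  have hprod : 1 / 4 ≤ α * f ^ k := by nlinarith
  have hε_prod : ε ≤ 4 * ε * (α * f ^ k) := by nlinarith
  have hε_α : ε ≤ 2 * ε * α := by nlinarith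
  have hden : 0 < α + e₀ := by linarith
  have hlower : f ^ k * (1 - 4 * ε) / (1 + 2 * ε) ≤ fhat ^ k := by
    rw [hdef]
    calc f ^ k * (1 - 4 * ε) / (1 + 2 * ε)
        = α * f ^ k * (1 - 4 * ε) / (α * (1 + 2 * ε)) := by field_simp
      _ ≤ (α * f ^ k + ek) / (α + e₀) :=
        div_le_div₀ hpos.le (by linarith) hden (by linarith)
  have hupper : fhat ^ k ≤ f ^ k * (1 + 4 * ε) / (1 - 2 * ε) := by
    have h2 : 0 < 1 - 2 * ε := by linarith
    rw [hdef]
    calc (α * f ^ k + ek) / (α + e₀)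
        ≤ α * f ^ k * (1 + 4 * ε) / (α * (1 - 2 * ε)) :=
        div_le_div₀ (by positivity) (by linarith) (by positivity) (by linarith)
      _ = f ^ k * (1 + 4 * ε) / (1 - 2 * ε) := by field_simp
  refine ⟨hlower, hupper, ?_⟩
  have hminus : 0 < 1 - 4 * ε := by linarith
  have hplus : 0 < 1 + 4 * ε := by linarith
  have hkpos : (0 : ℝ) < k := by exact_mod_cast hk
  have hupper_log : k * Real.log fhat ≤
      k * Real.log f + Real.log ((1 + 4 * ε) / (1 - 4 * ε)) := by
    rw [← Real.log_pow, ← Real.log_pow, ← Real.log_mul (by positivity) (by positivity)]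
    refine Real.log_le_log (by positivity) (hupper.trans ?_)
    rw [← mul_div_assoc]
    gcongr
    norm_num
  have hlower_log : k * Real.log f ≤
      k * Real.log fhat + Real.log ((1 + 4 * ε) / (1 - 4 * ε)) := by
    rw [← Real.log_pow, ← Real.log_pow, ← Real.log_mul (by positivity) (by positivity)]
    refine Real.log_le_log (by positivity) ?_
    rw [← mul_div_assoc, le_div_iff₀ hminus]
    rw [div_le_iff₀ (by linarith)] at hlower
    refine hlower.trans ?_
    gcongr
    norm_num
  rw [one_div_mul_eq_div, le_div_iff₀ hkpos, ← abs_of_pos hkpos, ← abs_mul,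
    abs_le]
  constructor <;> linarith
end

section
/- Let M be a real matrix with rows indexed by a finite set B and columns indexed by a finite set K, and suppose there exists σ > 0 such that σ·‖x‖₂ ≤ ‖M x‖₂ for every x : K → ℝ. Let λ : K → ℝ be entrywise nonnegative, set b = M λ, and let b̂ : B → ℝ satisfy |b̂_i − b_i| ≤ log(C)/(2k) for every i ∈ B, where C ≥ 1 and k is a positive integer. Let λ̂ be a minimizer of ‖M μ − b̂‖₂ over all entrywise nonnegative μ : K → ℝ. Then ‖λ̂ − λ‖₂ ≤ log(C)·√|B| / (2σk). -/
/-- First-order optimality of a least squares solution along a feasible segment: if `r` is the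
residual and moving by `-t • u` never shortens it for `t ∈ [0, 1]`, then `⟪r, u⟫ ≤ 0`. -/
theorem sum_mul_nonpos_of_forall_sum_sq_le {ι : Type*} [Fintype ι] (r u : ι → ℝ)
    (h : ∀ t : ℝ, 0 ≤ t → t ≤ 1 → ∑ i, r i ^ 2 ≤ ∑ i, (r i - t * u i) ^ 2) :
    ∑ i, r i * u i ≤ 0 := by
  have expand (t : ℝ) : ∑ i, (r i - t * u i) ^ 2 =
      ∑ i, r i ^ 2 - 2 * t * ∑ i, r i * u i + t ^ 2 * ∑ i, u i ^ 2 := by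
    simp only [Finset.mul_sum, ← Finset.sum_sub_distrib, ← Finset.sum_add_distrib]
    exact Finset.sum_congr rfl fun i _ => by ring
  simp only [expand] at h
  set p := ∑ i, r i * u i
  set q := ∑ i, u i ^ 2
  by_contra! hp
  have hpq : 2 * p ≤ q := by linarith [h 1 zero_le_one le_rfl]
  have hq : 0 < q := by linarith
  have key := h (p / q) (by positivity) ((div_le_one hq).2 (by linarith))
  have hsimp : (p / q) ^ 2 * q = p / q * p := by field_simp
  have hpos : 0 < p / q * p := by positivity
  linarith

theorem stmt4 {B K : Type*} [Fintype B] [Fintype K]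
    (M : Matrix B K ℝ) (σ : ℝ) (hσ : 0 < σ)
    (hM : ∀ x : K → ℝ,
      σ * Real.sqrt (∑ j, x j ^ 2) ≤ Real.sqrt (∑ i, (M.mulVec x i) ^ 2))
    (lam : K → ℝ) (hlam : ∀ j, 0 ≤ lam j)
    (C : ℝ) (hC : 1 ≤ C) (k : ℕ) (hk : 0 < k)
    (bhat : B → ℝ)
    (hbhat : ∀ i, |bhat i - M.mulVec lam i| ≤ Real.log C / (2 * k))
    (lamhat : K → ℝ) (hlamhat : ∀ j, 0 ≤ lamhat j)
    (hminimizer : ∀ μ : K → ℝ, (∀ j, 0 ≤ μ j) →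
      Real.sqrt (∑ i, (M.mulVec lamhat i - bhat i) ^ 2) ≤
        Real.sqrt (∑ i, (M.mulVec μ i - bhat i) ^ 2)) :
    Real.sqrt (∑ j, (lamhat j - lam j) ^ 2) ≤
      Real.log C * Real.sqrt (Fintype.card B) / (2 * σ * k) := by
  set u : B → ℝ := M.mulVec (fun j => lamhat j - lam j)
  have hu (i : B) : u i = M.mulVec lamhat i - M.mulVec lam i :=
    congrFun (Matrix.mulVec_sub M lamhat lam) i
  have hru : ∑ i, (M.mulVec lamhat i - bhat i) * u i ≤ 0 := by
    refine sum_mul_nonpos_of_forall_sum_sq_le _ _ fun t ht0 ht1 => ?_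
    have hmin := hminimizer (lamhat - t • (lamhat - lam)) fun j => by
      have h1 := mul_nonneg (sub_nonneg.2 ht1) (hlamhat j)
      have h2 := mul_nonneg ht0 (hlam j)
      simp only [Pi.sub_apply, Pi.smul_apply, smul_eq_mul]
      linarith
    rw [Real.sqrt_le_sqrt_iff (Finset.sum_nonneg fun i _ => sq_nonneg _)] at hmin
    refine hmin.trans_eq (Finset.sum_congr rfl fun i _ => ?_)
    simp only [Matrix.mulVec_sub, Matrix.mulVec_smul, Pi.sub_apply, Pi.smul_apply, smul_eq_mul, hu]
    ring
  have hue : ∑ i, u i ^ 2 ≤ ∑ i, (bhat i - M.mulVec lam i) ^ 2 := by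
    have hdiff : ∑ i, (bhat i - M.mulVec lam i) ^ 2 - ∑ i, u i ^ 2 =
        ∑ i, (M.mulVec lamhat i - bhat i) ^ 2 - 2 * ∑ i, (M.mulVec lamhat i - bhat i) * u i := by
      simp only [Finset.mul_sum, ← Finset.sum_sub_distrib, hu]
      exact Finset.sum_congr rfl fun i _ => by ring
    have hres : 0 ≤ ∑ i, (M.mulVec lamhat i - bhat i) ^ 2 :=
      Finset.sum_nonneg fun i _ => sq_nonneg _
    linarith
  have hk' : (0 : ℝ) < k := Nat.cast_pos.2 hk
  have hε : 0 ≤ Real.log C / (2 * k) := div_nonneg (Real.log_nonneg hC) (by positivity)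
  have hnoise : ∑ i, (bhat i - M.mulVec lam i) ^ 2 ≤
      Fintype.card B * (Real.log C / (2 * k)) ^ 2 := by
    rw [← nsmul_eq_mul]
    refine Finset.sum_le_card_nsmul _ _ _ fun i _ => ?_
    exact sq_le_sq' (abs_le.1 (hbhat i)).1 (abs_le.1 (hbhat i)).2
  have hsqrt := (hM fun j => lamhat j - lam j).trans (Real.sqrt_le_sqrt (hue.trans hnoise))
  rw [Real.sqrt_mul (Nat.cast_nonneg _), Real.sqrt_sq hε] at hsqrt
  calc Real.sqrt (∑ j, (lamhat j - lam j) ^ 2)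
      ≤ Real.sqrt (Fintype.card B) * (Real.log C / (2 * k)) / σ := by
        rwa [le_div_iff₀' hσ]
    _ = Real.log C * Real.sqrt (Fintype.card B) / (2 * σ * k) := by
        field_simp
end

section
/- Let B and K be finite sets of symplectic vectors over Fin n, let M = M(B,K), and suppose there exists σ > 0 with σ·‖x‖₂ ≤ ‖M x‖₂ for all x : K → ℝ. Let λ : K → ℝ be entrywise nonnegative and define the true fidelities f_b = exp(−2·(Mλ)_b) for b ∈ B. Let k be a positive integer such that f_b^k ≥ 1/2 for all b ∈ B, let 0 ≤ ε < 1/4, and for each b ∈ B let α_b ≥ 1/2 and let e_{b,0}, e_{b,k} be reals with |e_{b,0}| ≤ ε and |e_{b,k}| ≤ ε. Define estimated fidelities f̂_b > 0 by f̂_b^k = (α_b·f_b^k + e_{b,k})/(α_b + e_{b,0}), and let λ̂ be a minimizer of ‖M μ + (log f̂)/2‖₂ over all entrywise nonnegative μ : K → ℝ, where log f̂ is taken entrywise. Set C = (1+4ε)/(1−4ε) and τ = √(|K|·|B|)/(σk). Then for every vector m : K → ℝ with all entries in {0,1}, C^{−τ} ≤ exp(−2·Σ_{k∈K} m_k λ_k)·exp(2·Σ_{k∈K}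 m_k λ̂_k) ≤ C^{τ}. In other words, every fidelity predicted by the fitted model agrees with the corresponding true model fidelity up to a multiplicative factor between C^{−τ} and C^{τ}. -/
/-- If moving from `r` towards `r + u` never decreases the sum of squares, then `r` and `u` make a
non-obtuse angle, so `u` is no longer than `r + u`. -/
theorem sum_sq_le_sum_add_sq_of_forall_le {ι : Type*} [Fintype ι] (r u : ι → ℝ)
    (h : ∀ t : ℝ, 0 ≤ t → t ≤ 1 → ∑ i, r i ^ 2 ≤ ∑ i, (r i + t * u i) ^ 2) :
    ∑ i, u i ^ 2 ≤ ∑ i, (r i + u i) ^ 2 := by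
  have expand : ∀ t : ℝ, ∑ i, (r i + t * u i) ^ 2 =
      ∑ i, r i ^ 2 + 2 * t * ∑ i, r i * u i + t ^ 2 * ∑ i, u i ^ 2 := by
    intro t
    rw [Finset.mul_sum, Finset.mul_sum, ← Finset.sum_add_distrib, ← Finset.sum_add_distrib]
    exact Finset.sum_congr rfl fun i _ => by ring
  have hr : 0 ≤ ∑ i, r i ^ 2 := Finset.sum_nonneg fun i _ => sq_nonneg _
  have hu : 0 ≤ ∑ i, u i ^ 2 := Finset.sum_nonneg fun i _ => sq_nonneg _
  have hone := expand 1
  simp only [one_mul] at hone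
  simp only [expand] at h
  rw [hone]
  generalize ∑ i, r i * u i = p at *
  generalize ∑ i, u i ^ 2 = a at *
  suffices 0 ≤ p by linarith
  by_contra! hp
  have hap : 0 < a - p := by linarith
  have ht : 0 < -p / (a - p) := div_pos (by linarith) hap
  have ht1 : -p / (a - p) ≤ 1 := (div_le_one hap).2 (by linarith)
  have hta : -p / (a - p) * (a - p) = -p := div_mul_cancel₀ _ hap.ne'
  have := h _ ht.le ht1
  generalize -p / (a - p) = t at *
  nlinarith [mul_pos ht (neg_pos.2 hp), mul_pos (mul_pos ht ht) (neg_pos.2 hp)]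

/-- A ratio of perturbed measurements estimates `F` up to the factor `(1 + 4ε) / (1 - 4ε)`. -/
theorem abs_log_ratio_sub_log_le {α F ε d e : ℝ} (hF : 1 / 2 ≤ F) (hε : ε < 1 / 4)
    (hα : 1 / 2 ≤ α) (hd : |d| ≤ ε) (he : |e| ≤ ε) :
    |Real.log ((α * F + e) / (α + d)) - Real.log F| ≤
      Real.log ((1 + 4 * ε) / (1 - 4 * ε)) := by
  have hε0 : 0 ≤ ε := (abs_nonneg d).trans hd
  obtain ⟨hd1, hd2⟩ := abs_le.1 hd
  obtain ⟨he1, he2⟩ := abs_le.1 he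
  have hF0 : 0 < F := by linarith
  have hden : 0 < α + d := by linarith
  have hnum : 0 < α * F + e := by nlinarith
  have h1 : 0 < 1 + 4 * ε := by linarith
  have h2 : 0 < 1 - 4 * ε := by linarith
  have key1 : (α * F + e) * (1 - 4 * ε) ≤ (1 + 4 * ε) * (F * (α + d)) := by
    nlinarith [mul_nonneg (mul_nonneg hε0 hF0.le) (sub_nonneg.2 hα),
      mul_nonneg hε0 (sub_nonneg.2 hF), mul_nonneg h1.le (mul_nonneg hF0.le (by linarith : 0 ≤ d + ε)),
      mul_nonneg h2.le (sub_nonneg.2 he2), mul_nonneg (mul_nonneg hε0 hε0) hF0.le,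
      mul_nonneg (mul_nonneg hε0 hF0.le) (by linarith : 0 ≤ 1 / 4 - ε)]
  have key2 : (1 - 4 * ε) * (F * (α + d)) ≤ (α * F + e) * (1 + 4 * ε) := by
    nlinarith [mul_nonneg (mul_nonneg hε0 hF0.le) (sub_nonneg.2 hα),
      mul_nonneg hε0 (sub_nonneg.2 hF), mul_nonneg h2.le (mul_nonneg hF0.le (sub_nonneg.2 hd2)),
      mul_nonneg h1.le (by linarith : 0 ≤ e + ε), mul_nonneg (mul_nonneg hε0 hε0) hF0.le,
      mul_nonneg (mul_nonneg hε0 hε0) (sub_nonneg.2 hF),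
      mul_nonneg (mul_nonneg hε0 hF0.le) (by linarith : 0 ≤ 1 / 4 - ε)]
  have l1 := Real.log_le_log (mul_pos hnum h2) key1
  have l2 := Real.log_le_log (mul_pos h2 (mul_pos hF0 hden)) key2
  rw [Real.log_mul hnum.ne' h2.ne', Real.log_mul h1.ne' (mul_pos hF0 hden).ne',
    Real.log_mul hF0.ne' hden.ne'] at l1
  rw [Real.log_mul hnum.ne' h1.ne', Real.log_mul h2.ne' (mul_pos hF0 hden).ne',
    Real.log_mul hF0.ne' hden.ne'] at l2
  rw [Real.log_div hnum.ne' hden.ne', Real.log_div h1.ne' h2.ne', abs_le]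
  constructor <;> linarith

theorem stmt5 (n : ℕ)
    (B K : Finset (Fin n → ZMod 2 × ZMod 2))
    (M : Matrix ↥B ↥K ℝ)
    (hMdef : M = spMatrix (fun b : ↥B => (b : Fin n → ZMod 2 × ZMod 2))
      (fun k : ↥K => (k : Fin n → ZMod 2 × ZMod 2)))
    (σ : ℝ) (hσ : 0 < σ)
    (hM : ∀ x : ↥K → ℝ,
      σ * Real.sqrt (∑ j, x j ^ 2) ≤ Real.sqrt (∑ i, (M.mulVec x i) ^ 2))
    (lam : ↥K → ℝ) (hlam : ∀ j, 0 ≤ lam j)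
    (f : ↥B → ℝ) (hf : ∀ b, f b = Real.exp (-2 * M.mulVec lam b))
    (k : ℕ) (hk : 0 < k) (hfk : ∀ b, 1 / 2 ≤ f b ^ k)
    (ε : ℝ) (hε0 : 0 ≤ ε) (hε : ε < 1 / 4)
    (α : ↥B → ℝ) (hα : ∀ b, 1 / 2 ≤ α b)
    (e₀ ek : ↥B → ℝ) (he₀ : ∀ b, |e₀ b| ≤ ε) (hek : ∀ b, |ek b| ≤ ε)
    (fhat : ↥B → ℝ) (hfhatpos : ∀ b, 0 < fhat b)
    (hfhat : ∀ b, fhat b ^ k = (α b * f b ^ k + ek b) / (α b + e₀ b))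
    (lamhat : ↥K → ℝ) (hlamhat : ∀ j, 0 ≤ lamhat j)
    (hminimizer : ∀ μ : ↥K → ℝ, (∀ j, 0 ≤ μ j) →
      Real.sqrt (∑ i, (M.mulVec lamhat i + Real.log (fhat i) / 2) ^ 2) ≤
        Real.sqrt (∑ i, (M.mulVec μ i + Real.log (fhat i) / 2) ^ 2))
    (C τ : ℝ) (hC : C = (1 + 4 * ε) / (1 - 4 * ε))
    (hτ : τ = Real.sqrt ((K.card : ℝ) * (B.card : ℝ)) / (σ * k)) :
    ∀ m : ↥K → ℝ, (∀ j, m j = 0 ∨ m j = 1) →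
      C ^ (-τ) ≤ Real.exp (-2 * ∑ j, m j * lam j) * Real.exp (2 * ∑ j, m j * lamhat j) ∧
        Real.exp (-2 * ∑ j, m j * lam j) * Real.exp (2 * ∑ j, m j * lamhat j) ≤ C ^ τ := by
  have hC0 : 0 < C := hC ▸ div_pos (by linarith) (by linarith)
  have hk' : (0 : ℝ) < k := Nat.cast_pos.2 hk
  have hL : 0 ≤ Real.log C := by
    refine Real.log_nonneg ?_
    rw [hC, le_div_iff₀ (by linarith)]
    linarith
  have hres : ∀ b, |M.mulVec lam b + Real.log (fhat b) / 2| ≤ Real.log C / (2 * k) := by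
    intro b
    have h := abs_log_ratio_sub_log_le (hfk b) hε (hα b) (he₀ b) (hek b)
    rw [← hfhat, ← hC, Real.log_pow, Real.log_pow, hf, Real.log_exp,
      show (k : ℝ) * Real.log (fhat b) - k * (-2 * M.mulVec lam b) =
        (2 * k) * (M.mulVec lam b + Real.log (fhat b) / 2) by ring,
      abs_mul, abs_of_pos (by positivity : (0 : ℝ) < 2 * k)] at h
    rwa [le_div_iff₀' (by positivity)]
  have hproj := sum_sq_le_sum_add_sq_of_forall_le
    (fun i => M.mulVec lamhat i + Real.log (fhat i) / 2) (M.mulVec (lam - lamhat)) (by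
      intro t ht0 ht1
      have h := hminimizer (lamhat + t • (lam - lamhat)) (by
        intro j
        have h1 := mul_nonneg (sub_nonneg.2 ht1) (hlamhat j)
        have h2 := mul_nonneg ht0 (hlam j)
        simp only [Pi.add_apply, Pi.smul_apply, Pi.sub_apply, smul_eq_mul]
        linarith)
      rw [Real.sqrt_le_sqrt_iff (Finset.sum_nonneg fun i _ => sq_nonneg _)] at h
      refine h.trans_eq (Finset.sum_congr rfl fun i _ => ?_)
      rw [Matrix.mulVec_add, Matrix.mulVec_smul]
      simp only [Pi.add_apply, Pi.smul_apply, smul_eq_mul]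
      ring)
  have hsum : ∑ i, M.mulVec (lam - lamhat) i ^ 2 ≤ B.card * (Real.log C / (2 * k)) ^ 2 := by
    refine hproj.trans ((Finset.sum_le_card_nsmul _ _ ((Real.log C / (2 * k)) ^ 2) ?_).trans_eq
      (by simp))
    intro i _
    rw [Matrix.mulVec_sub, Pi.sub_apply]
    refine sq_le_sq' ?_ ?_ <;> linarith [(abs_le.1 (hres i)).1, (abs_le.1 (hres i)).2]
  have hdist : σ * Real.sqrt (∑ j, (lam - lamhat) j ^ 2) ≤
      Real.sqrt B.card * (Real.log C / (2 * k)) := by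
    refine ((hM _).trans (Real.sqrt_le_sqrt hsum)).trans_eq ?_
    rw [Real.sqrt_mul (Nat.cast_nonneg _), Real.sqrt_sq (by positivity)]
  intro m hm
  have hmsum : Real.sqrt (∑ j, m j ^ 2) ≤ Real.sqrt K.card := by
    refine Real.sqrt_le_sqrt ((Finset.sum_le_card_nsmul _ _ 1 ?_).trans_eq (by simp))
    intro j _
    rcases hm j with h | h <;> simp [h]
  have hcs : |∑ j, m j * (lam - lamhat) j| ≤
      Real.sqrt K.card * Real.sqrt (∑ j, (lam - lamhat) j ^ 2) := by
    refine (Real.abs_le_sqrt (Finset.sum_mul_sq_le_sq_mul_sq _ _ _)).trans ?_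
    rw [Real.sqrt_mul (Finset.sum_nonneg fun i _ => sq_nonneg _)]
    gcongr
  have hbound : |2 * ∑ j, m j * (lam - lamhat) j| ≤ Real.log C * τ := by
    have h : Real.sqrt (∑ j, (lam - lamhat) j ^ 2) ≤
        Real.sqrt B.card * (Real.log C / (2 * k)) / σ := (le_div_iff₀' hσ).2 hdist
    rw [abs_mul, abs_of_pos (two_pos : (0 : ℝ) < 2)]
    calc 2 * |∑ j, m j * (lam - lamhat) j|
        ≤ 2 * (Real.sqrt K.card * (Real.sqrt B.card * (Real.log C / (2 * k)) / σ)) := by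
          gcongr
          exact hcs.trans (by gcongr)
      _ = Real.log C * τ := by
          rw [hτ, Real.sqrt_mul (Nat.cast_nonneg _)]
          field_simp
  have hsplit : ∑ j, m j * (lam - lamhat) j = ∑ j, m j * lam j - ∑ j, m j * lamhat j := by
    simp [mul_sub]
  rw [hsplit, abs_le] at hbound
  rw [← Real.exp_add, Real.rpow_def_of_pos hC0, Real.rpow_def_of_pos hC0,
    Real.exp_le_exp, Real.exp_le_exp]
  constructor <;> linarith [hbound.1, hbound.2]
end

section
/- Under the same hypotheses as the model-fitting theorem — M = M(B,K) with σ·‖x‖₂ ≤ ‖Mx‖₂ for all x, true nonnegative coefficients λ with fidelities f_b = exp(−2(Mλ)_b), depth k with f_b^k ≥ 1/2, SPAM constants α_b ≥ 1/2, sampling errors bounded by ε < 1/4, estimated fidelities f̂_b^k = (α_b f_b^k + e_{b,k})/(α_b + e_{b,0}), and λ̂ a nonnegative least-squares minimizer of ‖Mμ + (log f̂)/2‖₂ — define the sampling-overhead factors γ = exp(2·Σ_{k∈K} λ_k) and γ̂ = exp(2·Σ_{k∈K} λ̂_k), and set C = (1+4ε)/(1−4ε) and τ = √(|K|·|B|)/(σk).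 Then γ·C^{−τ} ≤ γ̂ ≤ γ·C^{τ}. -/
/-- If `s` is a point of smallest norm on the segment from `s` to `s + u`, then
`‖u‖ ≤ ‖s + u‖`. -/
theorem sum_sq_le_sum_add_sq_of_segment_min {ι : Type*} [Fintype ι] (s u : ι → ℝ)
    (h : ∀ t : ℝ, 0 ≤ t → t ≤ 1 → ∑ i, s i ^ 2 ≤ ∑ i, (s i + t * u i) ^ 2) :
    ∑ i, u i ^ 2 ≤ ∑ i, (s i + u i) ^ 2 := by
  have expand (t : ℝ) : ∑ i, (s i + t * u i) ^ 2 =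
      ∑ i, s i ^ 2 + 2 * t * ∑ i, s i * u i + t ^ 2 * ∑ i, u i ^ 2 := by
    simp only [Finset.mul_sum, ← Finset.sum_add_distrib]
    exact Finset.sum_congr rfl fun i _ => by ring
  simp only [expand] at h
  have one := expand 1
  simp only [one_mul] at one
  rw [one]
  have hs : 0 ≤ ∑ i, s i ^ 2 := Finset.sum_nonneg fun i _ => sq_nonneg _
  have hu : 0 ≤ ∑ i, u i ^ 2 := Finset.sum_nonneg fun i _ => sq_nonneg _
  generalize ∑ i, s i * u i = a at *
  generalize ∑ i, u i ^ 2 = b at *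
  have ha : 0 ≤ a := by
    by_contra! ha
    have hba : 0 < b - a := by linarith
    set t := -a / (b - a) with ht
    have ht0 : 0 < t := div_pos (by linarith) hba
    have ht1 : t ≤ 1 := (div_le_one hba).2 (by linarith)
    have hta : t * (b - a) = -a := div_mul_cancel₀ _ hba.ne'
    nlinarith [h t ht0.le ht1, mul_pos ht0 (neg_pos.2 ha), mul_pos ht0 (mul_pos ht0 (neg_pos.2 ha))]
  linarith

/-- Nonnegative least squares is nonexpansive: the fit of a minimizer `y` differs from the fit of
any feasible `x` by at most the residual at `x`. -/
theorem nnls_fit_sub_le_residual {ι κ : Type*} [Fintype ι] [Fintype κ] (M : Matrix ι κ ℝ)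
    (c : ι → ℝ) (x y : κ → ℝ) (hx : ∀ j, 0 ≤ x j) (hy : ∀ j, 0 ≤ y j)
    (hmin : ∀ μ : κ → ℝ, (∀ j, 0 ≤ μ j) →
      √(∑ i, (M.mulVec y i + c i) ^ 2) ≤ √(∑ i, (M.mulVec μ i + c i) ^ 2)) :
    ∑ i, (M.mulVec (x - y) i) ^ 2 ≤ ∑ i, (M.mulVec x i + c i) ^ 2 := by
  have key := sum_sq_le_sum_add_sq_of_segment_min
    (fun i => M.mulVec y i + c i) (M.mulVec (x - y)) fun t ht0 ht1 => by
      have hμ : ∀ j, 0 ≤ (y + t • (x - y)) j := fun j => by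
        simp only [Pi.add_apply, Pi.smul_apply, Pi.sub_apply, smul_eq_mul]
        nlinarith [mul_nonneg ht0 (hx j), mul_nonneg (sub_nonneg.2 ht1) (hy j)]
      have h := (Real.sqrt_le_sqrt_iff (Finset.sum_nonneg fun i _ => sq_nonneg _)).1 (hmin _ hμ)
      refine h.trans_eq (Finset.sum_congr rfl fun i _ => ?_)
      rw [Matrix.mulVec_add, Matrix.mulVec_smul]
      simp only [Pi.add_apply, Pi.smul_apply, smul_eq_mul]
      ring
  refine key.trans_eq (Finset.sum_congr rfl fun i _ => ?_)
  rw [Matrix.mulVec_sub, Pi.sub_apply]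
  ring

/-- The logarithmic error of a fidelity estimated as a ratio of two noisy signals. -/
theorem abs_log_div_sub_log_le {a p e₀ e ε : ℝ} (hε : ε < 1 / 4) (ha : 1 / 2 ≤ a)
    (hp : 1 / 2 ≤ p) (he₀ : |e₀| ≤ ε) (he : |e| ≤ ε) :
    |Real.log ((a * p + e) / (a + e₀)) - Real.log p| ≤
      Real.log ((1 + 4 * ε) / (1 - 4 * ε)) := by
  obtain ⟨h₀l, h₀u⟩ := abs_le.1 he₀
  obtain ⟨hl, hu⟩ := abs_le.1 he
  have hε0 : 0 ≤ ε := (abs_nonneg _).trans he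
  have hap : 1 / 4 ≤ a * p := by nlinarith
  have hp0 : 0 < p := by linarith
  have ha0 : 0 < a := by linarith
  have hap0 : 0 < a * p := by linarith
  have hnum : 0 < a * p + e := by linarith
  have hden : 0 < a + e₀ := by linarith
  have hm : 0 < 1 - 4 * ε := by linarith
  have hq : 0 < 1 + 4 * ε := by linarith
  have n1 : (1 - 4 * ε) * (a * p) ≤ a * p + e := by nlinarith
  have n2 : a * p + e ≤ (1 + 4 * ε) * (a * p) := by nlinarith
  have d1 : (1 - 4 * ε) * a ≤ a + e₀ := by nlinarith
  have d2 : a + e₀ ≤ (1 + 4 * ε) * a := by nlinarith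
  have ln1 := Real.log_le_log (by positivity) n1
  have ln2 := Real.log_le_log hnum n2
  have ld1 := Real.log_le_log (by positivity) d1
  have ld2 := Real.log_le_log hden d2
  rw [Real.log_mul hm.ne' hap0.ne', Real.log_mul ha0.ne' hp0.ne'] at ln1
  rw [Real.log_mul hq.ne' hap0.ne', Real.log_mul ha0.ne' hp0.ne'] at ln2
  rw [Real.log_mul hm.ne' ha0.ne'] at ld1
  rw [Real.log_mul hq.ne' ha0.ne'] at ld2
  rw [Real.log_div hnum.ne' hden.ne', Real.log_div hq.ne' hm.ne', abs_le]
  constructor <;> linarith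

theorem stmt6 (n : ℕ)
    (B K : Finset (Fin n → ZMod 2 × ZMod 2))
    (M : Matrix ↥B ↥K ℝ)
    (hMdef : M = spMatrix (fun b : ↥B => (b : Fin n → ZMod 2 × ZMod 2))
      (fun k : ↥K => (k : Fin n → ZMod 2 × ZMod 2)))
    (σ : ℝ) (hσ : 0 < σ)
    (hM : ∀ x : ↥K → ℝ,
      σ * Real.sqrt (∑ j, x j ^ 2) ≤ Real.sqrt (∑ i, (M.mulVec x i) ^ 2))
    (lam : ↥K → ℝ) (hlam : ∀ j, 0 ≤ lam j)
    (f : ↥B → ℝ) (hf : ∀ b, f b = Real.exp (-2 * M.mulVec lam b))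
    (k : ℕ) (hk : 0 < k) (hfk : ∀ b, 1 / 2 ≤ f b ^ k)
    (ε : ℝ) (hε0 : 0 ≤ ε) (hε : ε < 1 / 4)
    (α : ↥B → ℝ) (hα : ∀ b, 1 / 2 ≤ α b)
    (e₀ ek : ↥B → ℝ) (he₀ : ∀ b, |e₀ b| ≤ ε) (hek : ∀ b, |ek b| ≤ ε)
    (fhat : ↥B → ℝ) (hfhatpos : ∀ b, 0 < fhat b)
    (hfhat : ∀ b, fhat b ^ k = (α b * f b ^ k + ek b) / (α b + e₀ b))
    (lamhat : ↥K → ℝ) (hlamhat : ∀ j, 0 ≤ lamhat j)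
    (hminimizer : ∀ μ : ↥K → ℝ, (∀ j, 0 ≤ μ j) →
      Real.sqrt (∑ i, (M.mulVec lamhat i + Real.log (fhat i) / 2) ^ 2) ≤
        Real.sqrt (∑ i, (M.mulVec μ i + Real.log (fhat i) / 2) ^ 2))
    (C τ γ γhat : ℝ) (hC : C = (1 + 4 * ε) / (1 - 4 * ε))
    (hτ : τ = Real.sqrt ((K.card : ℝ) * (B.card : ℝ)) / (σ * k))
    (hγ : γ = Real.exp (2 * ∑ j, lam j))
    (hγhat : γhat = Real.exp (2 * ∑ j, lamhat j)) :
    γ * C ^ (-τ) ≤ γhat ∧ γhat ≤ γ * C ^ τ := by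
  have hm : 0 < 1 - 4 * ε := by linarith
  have hC1 : 1 ≤ C := by rw [hC, le_div_iff₀ hm]; linarith
  have hC0 : 0 < C := by linarith
  have hL : 0 ≤ Real.log C := Real.log_nonneg hC1
  have hk0 : (0 : ℝ) < k := Nat.cast_pos.2 hk
  have hres (b : ↥B) : |M.mulVec lam b + Real.log (fhat b) / 2| ≤ Real.log C / (2 * k) := by
    have h := abs_log_div_sub_log_le hε (hα b) (hfk b) (he₀ b) (hek b)
    rw [← hfhat, ← hC, Real.log_pow, Real.log_pow, hf b, Real.log_exp] at h
    have heq : (k : ℝ) * Real.log (fhat b) - k * (-2 * M.mulVec lam b) =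
        (2 * k) * (M.mulVec lam b + Real.log (fhat b) / 2) := by ring
    rw [heq, abs_mul, abs_of_pos (by positivity : (0 : ℝ) < 2 * k)] at h
    rw [le_div_iff₀ (by positivity)]
    linarith
  have hfit : ∑ i, (M.mulVec (lam - lamhat) i) ^ 2 ≤ B.card * (Real.log C / (2 * k)) ^ 2 := by
    refine (nnls_fit_sub_le_residual M _ lam lamhat hlam hlamhat hminimizer).trans ?_
    have h := Finset.sum_le_card_nsmul (Finset.univ : Finset ↥B)
      (fun i => (M.mulVec lam i + Real.log (fhat i) / 2) ^ 2) ((Real.log C / (2 * k)) ^ 2)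
      fun b _ => sq_le_sq' (abs_le.1 (hres b)).1 (abs_le.1 (hres b)).2
    simpa using h
  have hnorm : σ * √(∑ j, (lam - lamhat) j ^ 2) ≤ √B.card * (Real.log C / (2 * k)) := by
    refine (hM _).trans ((Real.sqrt_le_sqrt hfit).trans_eq ?_)
    rw [Real.sqrt_mul (Nat.cast_nonneg _), Real.sqrt_sq (by positivity)]
  have hsum : |∑ j, (lam - lamhat) j| ≤ √K.card * √(∑ j, (lam - lamhat) j ^ 2) := by
    rw [← Real.sqrt_mul (Nat.cast_nonneg _)]
    refine Real.abs_le_sqrt ?_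
    simpa using sq_sum_le_card_mul_sum_sq (s := Finset.univ) (f := lam - lamhat)
  have hdiff : |2 * ∑ j, lam j - 2 * ∑ j, lamhat j| ≤ Real.log C * τ := by
    rw [← mul_sub, ← Finset.sum_sub_distrib, abs_mul, abs_two, hτ,
      Real.sqrt_mul (Nat.cast_nonneg _)]
    have hx : √(∑ j, (lam - lamhat) j ^ 2) ≤ √B.card * (Real.log C / (2 * k)) / σ := by
      rw [le_div_iff₀ hσ]
      linarith
    calc 2 * |∑ j, (lam j - lamhat j)|
        ≤ 2 * (√K.card * (√B.card * (Real.log C / (2 * k)) / σ)) :=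
          mul_le_mul_of_nonneg_left
            (hsum.trans (mul_le_mul_of_nonneg_left hx (Real.sqrt_nonneg _))) zero_le_two
      _ = Real.log C * (√K.card * √B.card / (σ * k)) := by field_simp
  obtain ⟨hl, hu⟩ := abs_le.1 hdiff
  rw [hγ, hγhat, Real.rpow_def_of_pos hC0, Real.rpow_def_of_pos hC0, ← Real.exp_add,
    ← Real.exp_add, Real.exp_le_exp, Real.exp_le_exp]
  constructor <;> linarith
end

section
/- Let G be a simple graph on the vertex set Fin n and suppose that for every vertex v, the number of neighbors u of v with u < v is at most 2. Then there exist nine functions s₁, …, s₉ : Fin n → Fin 3 such that for every edge {u,v} of G, the map i ↦ (sᵢ(u), sᵢ(v)) is a bijection from {1,…,9} onto Fin 3 × Fin 3; that is, the nine pairs of values at the endpoints of each edge exactly cover all nine elements of Fin 3 × Fin 3. -/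
/-- Greedy colouring: a graph on `Fin n` in which every vertex has at most `d` smaller neighbours
is `(d + 1)`-colourable. -/
theorem SimpleGraph.colorable_of_card_smaller_neighbors_le {n d : ℕ} (G : SimpleGraph (Fin n))
    [DecidableRel G.Adj]
    (hdeg : ∀ v : Fin n,
      (Finset.univ.filter (fun u : Fin n => G.Adj u v ∧ u < v)).card ≤ d) :
    G.Colorable (d + 1) := by
  have key : ∀ k : ℕ, ∃ c : Fin n → Fin (d + 1), ∀ u v : Fin n,
      u < v → v.val < k → G.Adj u v → c u ≠ c v := by
    intro k
    induction k with
    | zero => exact ⟨fun _ => 0, by simp⟩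
    | succ k ih =>
      obtain ⟨c, hc⟩ := ih
      by_cases hk : k < n
      · let w : Fin n := ⟨k, hk⟩
        let S := Finset.univ.filter (fun u : Fin n => G.Adj u w ∧ u < w)
        obtain ⟨a, ha⟩ : ∃ a, a ∉ S.image c := by
          by_contra! h
          have hcard : (S.image c).card = d + 1 := by
            rw [Finset.eq_univ_iff_forall.mpr h, Finset.card_univ, Fintype.card_fin]
          have := Finset.card_image_le (s := S) (f := c)
          have : S.card ≤ d := hdeg w
          omega
        refine ⟨Function.update c w a, fun u v huv hv hadj => ?_⟩
        by_cases hvw : v = w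
        · subst hvw
          rw [Function.update_of_ne huv.ne, Function.update_self]
          rintro rfl
          exact ha (Finset.mem_image_of_mem c (by simp [S, hadj, huv]))
        · have hvk : v.val < k := by
            have : v.val ≠ k := fun h => hvw (Fin.ext h)
            omega
          have huw : u ≠ w := fun h => by
            have : u.val = k := congrArg Fin.val h
            have : u.val < v.val := huv
            omega
          rw [Function.update_of_ne huw, Function.update_of_ne hvw]
          exact hc u v huv hvk hadj
      · exact ⟨c, fun u v huv _ hadj => hc u v huv (by omega) hadj⟩
  obtain ⟨c, hc⟩ := key n
  refine ⟨SimpleGraph.Coloring.mk c fun {u v} hadj => ?_⟩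
  rcases lt_or_gt_of_ne hadj.ne with h | h
  · exact hc u v h v.isLt hadj
  · exact (hc v u h u.isLt hadj.symm).symm

/-- Three pairwise orthogonal ternary arrays of length nine: writing the index as `(x, y)` in
base three, these are the linear forms `x`, `y` and `x + y` modulo three. -/
def orthogonalArray (c : Fin 3) (i : Fin 9) : Fin 3 :=
  ![Fin.ofNat 3 (i / 3), Fin.ofNat 3 i, Fin.ofNat 3 (i / 3 + i)] c

theorem orthogonalArray_bijective {a b : Fin 3} (h : a ≠ b) :
    Function.Bijective fun i => (orthogonalArray a i, orthogonalArray b i) := by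
  rw [Fintype.bijective_iff_injective_and_card]
  refine ⟨?_, by simp⟩
  revert a b
  unfold Function.Injective
  decide

theorem stmt7 (n : ℕ) (G : SimpleGraph (Fin n)) [DecidableRel G.Adj]
    (hdeg : ∀ v : Fin n,
      (Finset.univ.filter (fun u : Fin n => G.Adj u v ∧ u < v)).card ≤ 2) :
    ∃ s : Fin 9 → Fin n → Fin 3,
      ∀ u v : Fin n, G.Adj u v →
        Function.Bijective (fun i : Fin 9 => (s i u, s i v)) := by
  obtain ⟨C⟩ := G.colorable_of_card_smaller_neighbors_le hdeg
  exact ⟨fun i v => orthogonalArray (C v) i,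
    fun _ _ hadj => orthogonalArray_bijective (C.valid hadj)⟩
end

section
/- Let R be a normed ring (with submultiplicative norm and ‖1‖ ≤ 1), let l be a positive integer, let C ≥ 1, and let u₁, …, u_l and e₁, …, e_l be elements of R with ‖uᵢ‖ ≤ 1, ‖eᵢ‖ ≤ C, and ‖1 − eᵢ‖ ≤ C − 1 for every i. Then ‖(u_l·e_l)·(u_{l−1}·e_{l−1})⋯(u₁·e₁) − u_l·u_{l−1}⋯u₁‖ ≤ C^l − 1. -/
theorem List.norm_reverse_prod_ofFn_le_one {R : Type*} [NormedRing R] (hone : ‖(1 : R)‖ ≤ 1)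
    {n : ℕ} (u : Fin n → R) (hu : ∀ i, ‖u i‖ ≤ 1) : ‖(List.ofFn u).reverse.prod‖ ≤ 1 := by
  induction n with
  | zero => simpa using hone
  | succ n ih =>
    rw [List.ofFn_succ, List.reverse_cons, List.prod_append, List.prod_singleton]
    exact (norm_mul_le _ _).trans
      (mul_le_one₀ (ih (fun i => u i.succ) fun i => hu i.succ) (norm_nonneg _) (hu 0))

theorem norm_mul_mul_sub_mul_le {R : Type*} [NormedRing R] {p q u e : R} {B C : ℝ}
    (hpq : ‖p - q‖ ≤ B - 1) (hq : ‖q‖ ≤ 1) (hu : ‖u‖ ≤ 1) (he : ‖e‖ ≤ C)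
    (he1 : ‖1 - e‖ ≤ C - 1) : ‖p * (u * e) - q * u‖ ≤ B * C - 1 := by
  have hB : 0 ≤ B - 1 := (norm_nonneg _).trans hpq
  have hue : ‖u * e‖ ≤ C := (norm_mul_le _ _).trans
    ((mul_le_of_le_one_left (norm_nonneg _) hu).trans he)
  have hqu : ‖q * u‖ ≤ 1 := (norm_mul_le _ _).trans (mul_le_one₀ hq (norm_nonneg _) hu)
  calc ‖p * (u * e) - q * u‖ = ‖(p - q) * (u * e) - q * u * (1 - e)‖ := by
        congr 1; noncomm_ring
    _ ≤ ‖p - q‖ * ‖u * e‖ + ‖q * u‖ * ‖1 - e‖ :=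
        (norm_sub_le _ _).trans (add_le_add (norm_mul_le _ _) (norm_mul_le _ _))
    _ ≤ (B - 1) * C + 1 * (C - 1) := by gcongr
    _ = B * C - 1 := by ring

theorem stmt8 {R : Type*} [NormedRing R] (hone : ‖(1 : R)‖ ≤ 1)
    (l : ℕ) (hl : 0 < l) (C : ℝ) (hC : 1 ≤ C)
    (u e : Fin l → R)
    (hu : ∀ i, ‖u i‖ ≤ 1) (he : ∀ i, ‖e i‖ ≤ C) (he1 : ∀ i, ‖1 - e i‖ ≤ C - 1) :
    ‖(List.ofFn fun i : Fin l => u i * e i).reverse.prod -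
        (List.ofFn fun i : Fin l => u i).reverse.prod‖ ≤ C ^ l - 1 := by
  clear hl
  induction l with
  | zero => simp
  | succ n ih =>
    simp only [List.ofFn_succ, List.reverse_cons, List.prod_append, List.prod_singleton, pow_succ]
    exact norm_mul_mul_sub_mul_le
      (ih (fun i => u i.succ) (fun i => e i.succ) (fun i => hu i.succ) (fun i => he i.succ)
        fun i => he1 i.succ)
      (List.norm_reverse_prod_ofFn_le_one hone _ fun i => hu i.succ) (hu 0) (he 0) (he1 0)
end

section
/- Let m be a nonempty finite type, let K be a finite index set, let (A_k)_{k∈K} be a family of square complex matrices of size m that pairwise commute and satisfy A_k · A_k = 1 for every k, and let λ : K → ℝ. Set w_k = (1 + exp(−2·λ_k))/2 and γ = exp(2·Σ_{k∈K} λ_k). Then (∏_{k∈K} (w_k · 1 + (1 − w_k) · A_k)) · (γ · ∏_{k∈K} (w_k · 1 − (1 − w_k) · A_k)) = 1; moreover γ = ∏_{k∈K} (2w_k − 1)⁻¹. -/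
theorem List.prod_map_mul_prod_map_of_mul_eq_smul_one {ι R S : Type*} [CommSemiring R]
    [Semiring S] [Algebra R S] (f g : ι → S) (c : ι → R)
    (hfg : ∀ i j, Commute (f i) (g j)) (hc : ∀ i, f i * g i = c i • (1 : S)) (L : List ι) :
    (L.map f).prod * (L.map g).prod = (L.map c).prod • (1 : S) := by
  induction L with
  | nil => simp
  | cons a L ih =>
    have hcomm : Commute (L.map f).prod (g a) := by
      refine Commute.list_prod_left _ _ fun x hx => ?_
      obtain ⟨i, -, rfl⟩ := List.mem_map.mp hx
      exact hfg i a
    simp only [List.map_cons, List.prod_cons]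
    rw [hcomm.mul_mul_mul_comm, hc, ih, smul_mul_smul_comm, one_mul]

theorem smul_one_add_smul_mul_smul_one_sub_smul {R S : Type*} [CommRing R] [Ring S]
    [Algebra R S] (a b : R) {x : S} (hx : x * x = 1) :
    (a • (1 : S) + b • x) * (a • (1 : S) - b • x) = (a ^ 2 - b ^ 2) • (1 : S) := by
  simp only [add_mul, mul_sub, smul_mul_smul_comm, one_mul, mul_one, hx]
  rw [mul_comm b a]
  module

theorem Commute.smul_one_add_smul_smul_one_sub_smul {R S : Type*} [CommRing R] [Ring S]
    [Algebra R S] (a b c d : R) {x y : S} (h : Commute x y) :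
    Commute (a • (1 : S) + b • x) (c • (1 : S) - d • y) := by
  refine Commute.add_left ?_ (Commute.sub_right ?_ ((h.smul_left b).smul_right d))
  · exact (Commute.one_left _).smul_left a
  · exact (Commute.one_right _).smul_right c

theorem stmt13 {m : Type*} [Fintype m] [Nonempty m] [DecidableEq m]
    {K : Type*} [Fintype K]
    (A : K → Matrix m m ℂ)
    (hcomm : ∀ k k' : K, Commute (A k) (A k'))
    (hinvol : ∀ k, A k * A k = 1)
    (lam : K → ℝ) (w : K → ℝ) (γ : ℝ)
    (hw : ∀ k, w k = (1 + Real.exp (-2 * lam k)) / 2)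
    (hγ : γ = Real.exp (2 * ∑ k, lam k)) :
    (∀ L : List K, L.Nodup → (∀ k, k ∈ L) →
      (L.map fun k =>
          (w k : ℂ) • (1 : Matrix m m ℂ) + ((1 - w k : ℝ) : ℂ) • A k).prod *
        ((γ : ℂ) • (L.map fun k =>
          (w k : ℂ) • (1 : Matrix m m ℂ) - ((1 - w k : ℝ) : ℂ) • A k).prod) = 1) ∧
      γ = ∏ k, (2 * w k - 1)⁻¹ := by
  have hexp : ∀ k, 2 * w k - 1 = Real.exp (-2 * lam k) := fun k => by rw [hw]; ring
  have hγprod : γ = ∏ k, (2 * w k - 1)⁻¹ := by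
    rw [hγ, Finset.mul_sum, Real.exp_sum]
    refine Finset.prod_congr rfl fun k _ => ?_
    rw [hexp, ← Real.exp_neg]
    ring_nf
  refine ⟨fun L hL hmem => ?_, hγprod⟩
  classical
  have huniv : L.toFinset = Finset.univ := by
    ext k
    simp [hmem k]
  have hinv : γ * ∏ k, (2 * w k - 1) = 1 := by
    rw [hγprod, ← Finset.prod_mul_distrib]
    refine Finset.prod_eq_one fun k _ => inv_mul_cancel₀ ?_
    rw [hexp]
    exact (Real.exp_pos _).ne'
  rw [mul_smul_comm, List.prod_map_mul_prod_map_of_mul_eq_smul_one _ _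
    (fun k => ((2 * w k - 1 : ℝ) : ℂ))
    (fun i j => (hcomm i j).smul_one_add_smul_smul_one_sub_smul _ _ _ _)
    (fun k => ?_), ← List.prod_toFinset _ hL, huniv, smul_smul, ← Complex.ofReal_prod,
    ← Complex.ofReal_mul, hinv, Complex.ofReal_one, one_smul]
  rw [smul_one_add_smul_mul_smul_one_sub_smul _ _ (hinvol k)]
  congr 1
  push_cast
  ring
end

section
/- Let n be a positive integer. For a, b : Fin n → ZMod 2 × ZMod 2, the Pauli matrices satisfy P(a) · P(b) = (−1)^{⟨a,b⟩_sp} · (P(b) · P(a)), where (−1)^{⟨a,b⟩_sp} means 1 if ⟨a,b⟩_sp = 0 and −1 if ⟨a,b⟩_sp = 1. -/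
/-- The Pauli `X` matrix. -/
noncomputable def pauliX : Matrix (Fin 2) (Fin 2) ℂ := !![0, 1; 1, 0]

/-- The Pauli `Z` matrix. -/
noncomputable def pauliZ : Matrix (Fin 2) (Fin 2) ℂ := !![1, 0; 0, -1]

/-- The `n`-qubit Pauli matrix (up to phase) encoded by a symplectic vector, as the
`n`-fold Kronecker product of the single-qubit matrices `X^x_i * Z^z_i`, realized on
the index type `Fin n → Fin 2` of dimension `2 ^ n`. -/
noncomputable def pauliMat {n : ℕ} (a : Fin n → ZMod 2 × ZMod 2) :
    Matrix (Fin n → Fin 2) (Fin n → Fin 2) ℂ :=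
  Matrix.of fun x y => ∏ i, (pauliX ^ (a i).1.val * pauliZ ^ (a i).2.val) (x i) (y i)

theorem neg_one_pow_zmod_two_val_add (x y : ZMod 2) :
    (-1 : ℂ) ^ (x + y).val = (-1) ^ x.val * (-1) ^ y.val := by
  rw [ZMod.val_add, ← pow_add, ← neg_one_pow_eq_pow_mod_two]

theorem neg_one_pow_zmod_two_val_sum {ι : Type*} (s : Finset ι) (f : ι → ZMod 2) :
    (-1 : ℂ) ^ (∑ i ∈ s, f i).val = ∏ i ∈ s, (-1 : ℂ) ^ (f i).val := by
  classical
  induction s using Finset.induction_on with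
  | empty => simp
  | insert i s hi ih =>
    rw [Finset.sum_insert hi, Finset.prod_insert hi, neg_one_pow_zmod_two_val_add, ih]

/-- The product of two Kronecker products of families of matrices is the Kronecker product of
the factorwise products. -/
theorem Matrix.of_prod_mul_of_prod {ι m R : Type*} [Fintype ι] [DecidableEq ι] [Fintype m]
    [CommSemiring R] (A B : ι → Matrix m m R) :
    (Matrix.of fun x y : ι → m => ∏ i, A i (x i) (y i)) *
        (Matrix.of fun x y : ι → m => ∏ i, B i (x i) (y i)) =
      Matrix.of fun x y : ι → m => ∏ i, (A i * B i) (x i) (y i) := by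
  ext x y
  simp only [Matrix.mul_apply, Matrix.of_apply, ← Finset.prod_mul_distrib]
  exact (Fintype.prod_sum fun i j => A i (x i) j * B i j (y i)).symm

theorem pauli_single_mul_comm (a b : ZMod 2 × ZMod 2) :
    pauliX ^ a.1.val * pauliZ ^ a.2.val * (pauliX ^ b.1.val * pauliZ ^ b.2.val) =
      (-1 : ℂ) ^ (a.1 * b.2 + a.2 * b.1).val •
        (pauliX ^ b.1.val * pauliZ ^ b.2.val * (pauliX ^ a.1.val * pauliZ ^ a.2.val)) := by
  obtain ⟨x, z⟩ := a
  obtain ⟨x', z'⟩ := b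
  rw [neg_one_pow_zmod_two_val_add, ZMod.val_mul, ZMod.val_mul, ← neg_one_pow_eq_pow_mod_two,
    ← neg_one_pow_eq_pow_mod_two]
  fin_cases x <;> fin_cases z <;> fin_cases x' <;> fin_cases z' <;>
    simp [pauliX, pauliZ, ZMod.val]

theorem stmt14 (n : ℕ) (hn : 0 < n) (a b : Fin n → ZMod 2 × ZMod 2) :
    pauliMat a * pauliMat b =
      ((-1 : ℂ) ^ (spInner a b).val) • (pauliMat b * pauliMat a) := by
  unfold pauliMat spInner
  rw [Matrix.of_prod_mul_of_prod, Matrix.of_prod_mul_of_prod, neg_one_pow_zmod_two_val_sum]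
  ext x y
  simp only [pauli_single_mul_comm (a _) (b _), Matrix.of_apply, Matrix.smul_apply, smul_eq_mul,
    Finset.prod_mul_distrib]
end

section
/- Let n be a positive integer, let K be a finite index set, let k ↦ v_k assign to each k ∈ K a symplectic vector v_k : Fin n → ZMod 2 × ZMod 2, and let λ : K → ℝ with w_k = (1 + exp(−2·λ_k))/2. For each k define the linear map Φ_k on 2^n × 2^n complex matrices by Φ_k(ρ) = w_k · ρ + (1 − w_k) · P(v_k) · ρ · P(v_k)ᴴ. Then for every symplectic vector a : Fin n → ZMod 2 × ZMod 2 and every enumeration of K as a list, the composition of the maps Φ_k over that list satisfies (Φ_{k_|K|} ∘ ⋯ ∘ Φ_{k_1})(P(a)) = exp(−2 · Σ_{k∈K} λ_k · ι(⟨a, v_k⟩_sp)) · P(a), where ι : ZMod 2 → ℝ sends 0 to 0 and 1 to 1. In particular each Pauli matrix P(a) is an eigenvector of the sparse Pauli-Lindblad channel with eigenvalue (fidelity) f_a = exp(−2·Σ_k λ_k·ι(⟨a,v_k⟩_sp)). -/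
open Matrix

/-- The map `ι : ZMod 2 → ℝ` sending `0 ↦ 0` and `1 ↦ 1`. -/
def zmodToReal (t : ZMod 2) : ℝ := (t.val : ℝ)

/-- The sign character `0 ↦ 1`, `1 ↦ -1` of `ZMod 2`. -/
noncomputable def zmodSign (t : ZMod 2) : ℝ := (-1) ^ t.val

@[simp]
theorem zmodSign_zero : zmodSign 0 = 1 := by simp [zmodSign]

@[simp]
theorem zmodSign_one : zmodSign 1 = -1 := by simp [zmodSign, ZMod.val_one]

theorem ZMod.two_eq_zero_or_one (t : ZMod 2) : t = 0 ∨ t = 1 := by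
  decide +revert

theorem zmodSign_add (s t : ZMod 2) : zmodSign (s + t) = zmodSign s * zmodSign t := by
  rcases ZMod.two_eq_zero_or_one s with rfl | rfl <;>
    rcases ZMod.two_eq_zero_or_one t with rfl | rfl <;> simp [CharTwo.add_self_eq_zero]

theorem zmodSign_sum {ι : Type*} (s : Finset ι) (f : ι → ZMod 2) :
    zmodSign (∑ i ∈ s, f i) = ∏ i ∈ s, zmodSign (f i) := by
  classical
  induction s using Finset.induction_on with
  | empty => simp [zmodSign]
  | insert i s hi ih => rw [Finset.sum_insert hi, Finset.prod_insert hi, zmodSign_add, ih]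

/-- The Kronecker product of a family of matrices. -/
def piKronecker {ι m R : Type*} [Fintype ι] [CommSemiring R] (A : ι → Matrix m m R) :
    Matrix (ι → m) (ι → m) R :=
  Matrix.of fun x y => ∏ i, A i (x i) (y i)

theorem piKronecker_mul {ι m R : Type*} [Fintype ι] [DecidableEq ι] [Fintype m]
    [CommSemiring R] (A B : ι → Matrix m m R) :
    piKronecker A * piKronecker B = piKronecker fun i => A i * B i := by
  ext x y
  simp only [piKronecker, Matrix.mul_apply, Matrix.of_apply, Fintype.prod_sum,
    Finset.prod_mul_distrib]

theorem conjTranspose_piKronecker {ι m R : Type*} [Fintype ι] [CommSemiring R] [StarRing R]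
    (A : ι → Matrix m m R) : (piKronecker A)ᴴ = piKronecker fun i => (A i)ᴴ := by
  ext x y
  simp [piKronecker, Matrix.conjTranspose_apply]

theorem piKronecker_smul {ι m : Type*} [Fintype ι] (c : ι → ℝ) (A : ι → Matrix m m ℂ) :
    piKronecker (fun i => c i • A i) = (∏ i, c i) • piKronecker A := by
  ext x y
  simp [piKronecker, Finset.prod_mul_distrib]

theorem pauli_conj_single (a b : ZMod 2 × ZMod 2) :
    (pauliX ^ b.1.val * pauliZ ^ b.2.val) * (pauliX ^ a.1.val * pauliZ ^ a.2.val) *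
      (pauliX ^ b.1.val * pauliZ ^ b.2.val)ᴴ =
        zmodSign (a.1 * b.2 + a.2 * b.1) • (pauliX ^ a.1.val * pauliZ ^ a.2.val) := by
  obtain ⟨a₁, a₂⟩ := a
  obtain ⟨b₁, b₂⟩ := b
  rcases ZMod.two_eq_zero_or_one a₁ with rfl | rfl <;>
    rcases ZMod.two_eq_zero_or_one a₂ with rfl | rfl <;>
    rcases ZMod.two_eq_zero_or_one b₁ with rfl | rfl <;>
    rcases ZMod.two_eq_zero_or_one b₂ with rfl | rfl <;>
    ext i j <;> fin_cases i <;> fin_cases j <;>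
    simp [pauliX, pauliZ, ZMod.val_one, CharTwo.add_self_eq_zero, Matrix.mul_apply,
      Fin.sum_univ_two]

theorem pauliMat_conj {n : ℕ} (a b : Fin n → ZMod 2 × ZMod 2) :
    pauliMat b * pauliMat a * (pauliMat b)ᴴ = zmodSign (spInner a b) • pauliMat a := by
  have h (c : Fin n → ZMod 2 × ZMod 2) :
      pauliMat c = piKronecker fun i => pauliX ^ (c i).1.val * pauliZ ^ (c i).2.val := rfl
  simp only [h, conjTranspose_piKronecker, piKronecker_mul, pauli_conj_single,
    piKronecker_smul, spInner, zmodSign_sum]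

theorem pauliLindblad_weight (l : ℝ) (t : ZMod 2) :
    (1 + Real.exp (-2 * l)) / 2 + (1 - (1 + Real.exp (-2 * l)) / 2) * zmodSign t =
      Real.exp (-2 * (l * zmodToReal t)) := by
  rcases ZMod.two_eq_zero_or_one t with rfl | rfl
  · simp [zmodToReal]
  · simp [zmodToReal, ZMod.val_one]
    ring

theorem stmt15 (n : ℕ) (hn : 0 < n) {K : Type*} [Fintype K]
    (v : K → (Fin n → ZMod 2 × ZMod 2)) (lam : K → ℝ) (w : K → ℝ)
    (hw : ∀ k, w k = (1 + Real.exp (-2 * lam k)) / 2)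
    (Φ : K → Matrix (Fin n → Fin 2) (Fin n → Fin 2) ℂ →
      Matrix (Fin n → Fin 2) (Fin n → Fin 2) ℂ)
    (hΦ : ∀ k ρ, Φ k ρ = w k • ρ + (1 - w k) • (pauliMat (v k) * ρ * (pauliMat (v k))ᴴ)) :
    ∀ a : Fin n → ZMod 2 × ZMod 2, ∀ L : List K, L.Nodup → (∀ k, k ∈ L) →
      List.foldr (fun k acc => Φ k ∘ acc) id L (pauliMat a) =
        Real.exp (-2 * ∑ k, lam k * zmodToReal (spInner a (v k))) • pauliMat a := by
  intro a L hL hmem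
  classical
  have hlist (l : List K) : List.foldr (fun k acc => Φ k ∘ acc) id l (pauliMat a) =
      Real.exp (-2 * (l.map fun k => lam k * zmodToReal (spInner a (v k))).sum) •
        pauliMat a := by
    induction l with
    | nil => simp
    | cons k l ih =>
      rw [List.foldr_cons, Function.comp_apply, ih, hΦ, Matrix.mul_smul, Matrix.smul_mul,
        pauliMat_conj, List.map_cons, List.sum_cons, mul_add, Real.exp_add,
        ← pauliLindblad_weight, ← hw]
      module
  have huniv : L.toFinset = Finset.univ := by
    ext k
    simp [hmem k]
  rw [hlist, ← List.sum_toFinset _ hL, huniv]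
end
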